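/- There exists a cyclically 5-edge-connected cubic graph G on 34 vertices (hence not the Petersen graph) together with an eulerian (1,2)-weight w of G such that the weight sum over every cyclic edge cut of G is strictly greater than 4 and (G, w) has no compatible cycle cover. In particular, the conjecture of Zhang that the Petersen graph is the only bridgeless cubic graph admitting such a weight with no compatible cycle cover is false. -/

import Mathlib

open scoped Classical

namespace SnarkPaper

variable {V : Type*}

/-- A graph is cubic if every vertex has exactly 3 neighbours. -/
def IsCubic (G : SimpleGraph V) : Prop := ∀ v : V, (G.neighborSet v).ncard = 3

/-- A proper 3-edge-colouring: edges sharing an endpoint get different colours. -/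
def Colourable3 (G : SimpleGraph V) : Prop :=
  ∃ c : Sym2 V → Fin 3, ∀ e₁ ∈ G.edgeSet, ∀ e₂ ∈ G.edgeSet,
    e₁ ≠ e₂ → (∃ v, v ∈ e₁ ∧ v ∈ e₂) → c e₁ ≠ c e₂

/-- A subgraph is 2-regular if every one of its vertices has exactly two neighbours in it. -/
def IsTwoRegular {G : SimpleGraph V} (H : G.Subgraph) : Prop :=
  ∀ v ∈ H.verts, (H.neighborSet v).ncard = 2

/-- A cycle is a connected 2-regular subgraph. -/
def IsCycleSub {G : SimpleGraph V} (C : G.Subgraph) : Prop :=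
  C.Connected ∧ IsTwoRegular C

/-- A 2-factor is a spanning 2-regular subgraph. -/
def IsTwoFactor {G : SimpleGraph V} (F : G.Subgraph) : Prop :=
  F.IsSpanning ∧ IsTwoRegular F

/-- A 2-factor is even if all its cycles (connected components) have even length. -/
def IsEvenTwoFactor {G : SimpleGraph V} (F : G.Subgraph) : Prop :=
  IsTwoFactor F ∧ ∀ C : G.Subgraph, C ≤ F → IsCycleSub C → Even C.verts.ncard

/-- An even subgraph: every vertex has even degree. -/
def IsEvenSubgraph {G : SimpleGraph V} (H : G.Subgraph) : Prop :=
  ∀ v : V, Even (H.neighborSet v).ncard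

/-- A cycle double cover: a multiset of cycles covering each edge exactly twice. -/
def IsCDC (G : SimpleGraph V) (D : Multiset G.Subgraph) : Prop :=
  (∀ C ∈ D, IsCycleSub C) ∧
  ∀ e ∈ G.edgeSet, D.countP (fun C => e ∈ C.edgeSet) = 2

/-- A k-CDC, seen as a multiset of k even subgraphs covering each edge exactly twice. -/
def IsKCDC (G : SimpleGraph V) (k : ℕ) (D : Multiset G.Subgraph) : Prop :=
  D.card = k ∧ (∀ H ∈ D, IsEvenSubgraph H) ∧
  ∀ e ∈ G.edgeSet, D.countP (fun H => e ∈ H.edgeSet) = 2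

/-- An edge set is even if every vertex meets an even number of its edges. -/
def EvenEdgeSet (S : Set (Sym2 V)) : Prop :=
  ∀ v : V, Even {w : V | s(v, w) ∈ S}.ncard

/-- A k-CDC presented as a multiset of k even edge sets covering each edge exactly twice. -/
def IsKCDCEdgeSets (G : SimpleGraph V) (k : ℕ) (D : Multiset (Set (Sym2 V))) : Prop :=
  D.card = k ∧ (∀ S ∈ D, S ⊆ G.edgeSet ∧ EvenEdgeSet S) ∧
  ∀ e ∈ G.edgeSet, D.countP (fun S => e ∈ S) = 2

/-- The set A contains (the vertices of) a cycle of G. -/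
def HasCycleIn (G : SimpleGraph V) (A : Set V) : Prop :=
  ∃ C : G.Subgraph, IsCycleSub C ∧ C.verts ⊆ A

/-- The edges of G crossing between A and its complement. -/
def cutEdges (G : SimpleGraph V) (A : Set V) : Set (Sym2 V) :=
  {e ∈ G.edgeSet | ∃ x ∈ A, ∃ y ∉ A, e = s(x, y)}

/-- Cyclically k-edge-connected: every edge cut separating two cycles has at least k edges. -/
def CyclEdgeConn (G : SimpleGraph V) (k : ℕ) : Prop :=
  ∀ A : Set V, HasCycleIn G A → HasCycleIn G Aᶜ → k ≤ (cutEdges G A).ncard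

/-- A snark: an uncolourable cyclically 4-edge-connected cubic graph with girth at least 5. -/
def IsSnark (G : SimpleGraph V) : Prop :=
  IsCubic G ∧ ¬ Colourable3 G ∧ CyclEdgeConn G 4 ∧ 5 ≤ G.girth

/-- The edge-insertion operation applied to the edges ab and cd of G: subdivide each with a
new vertex (u = inr 0, v = inr 1) and join the two new vertices by an edge. -/
def edgeInsertion (G : SimpleGraph V) (a b c d : V) : SimpleGraph (V ⊕ Fin 2) :=
  SimpleGraph.fromEdgeSet
    ((Sym2.map Sum.inl '' (G.edgeSet \ {s(a, b), s(c, d)})) ∪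
      {s(Sum.inl a, Sum.inr 0), s(Sum.inr 0, Sum.inl b),
       s(Sum.inl c, Sum.inr 1), s(Sum.inr 1, Sum.inl d),
       s(Sum.inr 0, Sum.inr 1)})

/-- A permutation graph: a cubic graph with a 2-factor consisting of two induced cycles. -/
def IsPermutationGraph (G : SimpleGraph V) : Prop :=
  IsCubic G ∧ ∃ C₁ C₂ : G.Subgraph, IsCycleSub C₁ ∧ IsCycleSub C₂ ∧
    C₁.IsInduced ∧ C₂.IsInduced ∧ Disjoint C₁.verts C₂.verts ∧ IsTwoFactor (C₁ ⊔ C₂)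

/-- The total weight of the edge cut determined by A. -/
noncomputable def cutWeight (G : SimpleGraph V) (w : Sym2 V → ℕ) (A : Set V) : ℕ :=
  ∑ᶠ e ∈ cutEdges G A, w e

/-- An eulerian (1,2)-weight: each edge gets weight 1 or 2 and every edge cut has even weight. -/
def IsEulerianWeight (G : SimpleGraph V) (w : Sym2 V → ℕ) : Prop :=
  (∀ e ∈ G.edgeSet, w e = 1 ∨ w e = 2) ∧ ∀ A : Set V, Even (cutWeight G w A)

/-- A compatible cycle cover of (G, w): each edge e lies in exactly w(e) of the cycles. -/
def IsCompatibleCycleCover (G : SimpleGraph V) (w : Sym2 V → ℕ)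
    (D : Multiset G.Subgraph) : Prop :=
  (∀ C ∈ D, IsCycleSub C) ∧
  ∀ e ∈ G.edgeSet, D.countP (fun C => e ∈ C.edgeSet) = w e


/-! ### The graph

Two 17-cycles `0,…,16` and `17,…,33` joined by a perfect matching `mt`. -/

def mtL : List ℕ :=
  [17, 21, 27, 33, 26, 28, 19, 22, 20, 31, 29, 32, 23, 25, 18, 24, 30,
   0, 14, 6, 8, 1, 7, 12, 15, 13, 4, 2, 5, 10, 16, 9, 11, 3]

/-- The partner of a vertex in the perfect matching. -/
def mt (x : Fin 34) : Fin 34 := Fin.ofNat 34 (mtL.getD x.val 0)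

/-- The successor of a vertex on its 17-cycle. -/
def nx (x : Fin 34) : Fin 34 :=
  Fin.ofNat 34 (if x.val < 17 then (x.val + 1) % 17 else 17 + (x.val - 16) % 17)

/-- The predecessor of a vertex on its 17-cycle. -/
def pv (x : Fin 34) : Fin 34 :=
  Fin.ofNat 34 (if x.val < 17 then (x.val + 16) % 17 else 17 + (x.val - 1) % 17)

lemma mt_mt : ∀ x, mt (mt x) = x := by decide +kernel
lemma nx_pv : ∀ x, nx (pv x) = x := by decide +kernel
lemma pv_nx : ∀ x, pv (nx x) = x := by decide +kernel
lemma pv_ne_nx : ∀ x, pv x ≠ nx x := by decide +kernel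
lemma pv_ne_mt : ∀ x, pv x ≠ mt x := by decide +kernel
lemma nx_ne_mt : ∀ x, nx x ≠ mt x := by decide +kernel
lemma pv_ne : ∀ x, x ≠ pv x := by decide +kernel
lemma nx_ne : ∀ x, x ≠ nx x := by decide +kernel
lemma mt_ne : ∀ x, x ≠ mt x := by decide +kernel

/-- The permutation graph. -/
def PG : SimpleGraph (Fin 34) where
  Adj x y := y = pv x ∨ y = nx x ∨ y = mt x
  symm := ⟨by
    rintro x y (h | h | h)
    · subst h; exact Or.inr (Or.inl (nx_pv x).symm)
    · subst h; exact Or.inl (pv_nx x).symm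
    · subst h; exact Or.inr (Or.inr (mt_mt x).symm)⟩
  loopless := ⟨by
    rintro x (h | h | h)
    · exact pv_ne x h
    · exact nx_ne x h
    · exact mt_ne x h⟩

lemma PG_adj (x y : Fin 34) : PG.Adj x y ↔ (y = pv x ∨ y = nx x ∨ y = mt x) := Iff.rfl

/-- Weight 2 on the matching, weight 1 elsewhere. -/
def wt : Sym2 (Fin 34) → ℕ :=
  Sym2.lift ⟨fun x y => if y = mt x then 2 else 1, by
    intro x y
    have : y = mt x ↔ x = mt y := by
      constructor <;> (intro h; rw [h, mt_mt])
    simp only [this]⟩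

lemma wt_mk (x y : Fin 34) : wt s(x, y) = if y = mt x then 2 else 1 := rfl

lemma PG_cubic : IsCubic PG := by
  intro v
  rw [Set.ncard_eq_three]
  refine ⟨pv v, nx v, mt v, pv_ne_nx v, pv_ne_mt v, nx_ne_mt v, ?_⟩
  ext y
  simp [PG_adj]

/-! ### Local structure of cycles -/

lemma cycle_local {C : PG.Subgraph} (hC : IsCycleSub C) {v u : Fin 34} (h : C.Adj v u) :
    (C.Adj v (pv v) ∧ C.Adj v (nx v) ∧ ¬ C.Adj v (mt v)) ∨
    (C.Adj v (pv v) ∧ ¬ C.Adj v (nx v) ∧ C.Adj v (mt v)) ∨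
    (¬ C.Adj v (pv v) ∧ C.Adj v (nx v) ∧ C.Adj v (mt v)) := by
  have h2 := hC.2 v h.fst_mem
  rw [Set.ncard_eq_two] at h2
  obtain ⟨a, b, hab, hs⟩ := h2
  have key : ∀ y, C.Adj v y ↔ (y = a ∨ y = b) := by
    intro y
    have : y ∈ C.neighborSet v ↔ y ∈ ({a, b} : Set (Fin 34)) := by rw [hs]
    simpa using this
  have ha : PG.Adj v a := ((key a).2 (Or.inl rfl)).adj_sub
  have hb : PG.Adj v b := ((key b).2 (Or.inr rfl)).adj_sub
  rw [PG_adj] at ha hb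
  have h1 := pv_ne_nx v
  have h2 := pv_ne_mt v
  have h3 := nx_ne_mt v
  simp only [key]
  clear key hs h
  grind

lemma three_of_hasCycle {A : Set (Fin 34)} (h : HasCycleIn PG A) :
    ∃ x y z, x ∈ A ∧ y ∈ A ∧ z ∈ A ∧ x ≠ y ∧ x ≠ z ∧ y ≠ z := by
  obtain ⟨C, hC, hA⟩ := h
  obtain ⟨v, hv⟩ : C.verts.Nonempty := hC.1.nonempty
  have h2 := hC.2 v hv
  rw [Set.ncard_eq_two] at h2
  obtain ⟨a, b, hab, hs⟩ := h2
  have ha : C.Adj v a := by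
    have : a ∈ C.neighborSet v := by rw [hs]; simp
    exact this
  have hb : C.Adj v b := by
    have : b ∈ C.neighborSet v := by rw [hs]; simp
    exact this
  exact ⟨v, a, b, hA hv, hA ha.snd_mem, hA hb.snd_mem, ha.ne, hb.ne, hab⟩

/-! ### Small edge cuts -/

/-- Vertices in a convenient order, each with its neighbours occurring earlier. -/
def steps : List (ℕ × List ℕ) :=
  [(3, []), (33, [3]), (4, [3]), (17, [33]), (32, [33]), (31, [32]), (26, [4]), (2, [3]),
   (27, [26, 2]), (5, [4]), (28, [27, 5]), (0, [17]), (1, [0, 2]), (30, [31]), (16, [0, 30]),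
   (29, [28, 30]), (18, [17]), (11, [32]), (10, [11, 29]), (9, [10, 31]), (25, [26]),
   (15, [16]), (14, [15, 18]), (24, [25, 15]), (13, [14, 25]), (12, [11, 13]), (23, [24, 12]),
   (6, [5]), (19, [18, 6]), (21, [1]), (22, [21, 23]), (7, [6, 22]), (8, [7, 9]),
   (20, [19, 21, 8])]

/-- Number of members of the list whose bit is set in the mask. -/
def hits (m : ℕ) : List ℕ → ℕ
  | [] => 0
  | b :: bs => (m.testBit b).toNat + hits m bs

/-- Branch on the side of every vertex; `m1`, `m0` are the masks of the two sides, `c` the number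
of cut edges so far, `s` and `t` the sizes of the two sides. -/
def chk : List (ℕ × List ℕ) → ℕ → ℕ → ℕ → ℕ → ℕ → Bool
  | [], _, _, _, s, t => Nat.ble s 2 || Nat.ble t 2
  | (v, bs) :: rest, m1, m0, c, s, t =>
    (Nat.ble 5 (c + hits m0 bs) ||
      chk rest (m1 ||| 2 ^ v) m0 (c + hits m0 bs) (s + 1) t) &&
    (Nat.ble 5 (c + hits m1 bs) ||
      chk rest m1 (m0 ||| 2 ^ v) (c + hits m1 bs) s (t + 1))

lemma chk_steps : chk steps 0 0 0 0 0 = true := by decide +kernel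

/-- Number of back neighbours on the other side. -/
def mism (a : ℕ → Bool) (v : ℕ) (bs : List ℕ) : ℕ := bs.countP (fun b => a v != a b)

lemma hits_le (a : ℕ → Bool) (m v : ℕ) (h : ∀ u, m.testBit u = true → (a v != a u) = true)
    (bs : List ℕ) : hits m bs ≤ mism a v bs := by
  induction bs with
  | nil => simp [hits]
  | cons b bs ih =>
    unfold mism at *
    rw [hits, List.countP_cons]
    cases hb : m.testBit b
    · simp; omega
    · rw [if_pos (h b hb)]; simp; omega

lemma chk_sound (a : ℕ → Bool) : ∀ (l : List (ℕ × List ℕ)) (m1 m0 c s t : ℕ),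
    chk l m1 m0 c s t = true →
    (∀ u, m1.testBit u = true → a u = true) → (∀ u, m0.testBit u = true → a u = false) →
    c + (l.map (fun q => mism a q.1 q.2)).sum ≤ 4 →
    s + (l.map Prod.fst).countP (fun v => a v) ≤ 2 ∨
      t + (l.map Prod.fst).countP (fun v => !a v) ≤ 2 := by
  intro l
  induction l with
  | nil =>
    intro m1 m0 c s t h _ _ _
    simpa [chk] using h
  | cons q rest ih =>
    obtain ⟨v, bs⟩ := q
    intro m1 m0 c s t h h1 h0 hc
    simp only [chk, Bool.and_eq_true, Bool.or_eq_true, Nat.ble_eq] at h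
    simp only [List.map_cons, List.sum_cons] at hc
    cases hv : a v
    · have hle := hits_le a m1 v (by intro u hu; rw [h1 u hu, hv]; rfl) bs
      rcases h.2 with h | h
      · omega
      · have := ih _ _ _ _ _ h h1 (by
          intro u hu
          rw [Nat.testBit_or, Nat.testBit_two_pow, Bool.or_eq_true] at hu
          rcases hu with hu | hu
          · exact h0 u hu
          · rw [← of_decide_eq_true hu]; exact hv) (by omega)
        simp only [List.map_cons, List.countP_cons, hv]
        simp only [Bool.not_true, Bool.not_false, Bool.false_eq_true, if_true, if_false]
        omega
    · have hle := hits_le a m0 v (by intro u hu; rw [h0 u hu, hv]; rfl) bs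
      rcases h.1 with h | h
      · omega
      · have := ih _ _ _ _ _ h (by
          intro u hu
          rw [Nat.testBit_or, Nat.testBit_two_pow, Bool.or_eq_true] at hu
          rcases hu with hu | hu
          · exact h1 u hu
          · rw [← of_decide_eq_true hu]; exact hv) h0 (by omega)
        simp only [List.map_cons, List.countP_cons, hv]
        simp only [Bool.not_true, Bool.not_false, Bool.false_eq_true, if_true, if_false]
        omega

/-- The 51 edges, read off from `steps`. -/
def edgeL (l : List (ℕ × List ℕ)) : List (ℕ × ℕ) := l.flatMap (fun q => q.2.map (fun b => (q.1, b)))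

def toE (p : ℕ × ℕ) : Sym2 (Fin 34) := s(Fin.ofNat 34 p.1, Fin.ofNat 34 p.2)

lemma edgeL_nodup : ((edgeL steps).map toE).Nodup := by decide +kernel

lemma edgeL_adj : ∀ p ∈ edgeL steps, Fin.ofNat 34 p.2 = pv (Fin.ofNat 34 p.1) ∨
    Fin.ofNat 34 p.2 = nx (Fin.ofNat 34 p.1) ∨ Fin.ofNat 34 p.2 = mt (Fin.ofNat 34 p.1) := by
  decide +kernel

lemma steps_all : ∀ x : Fin 34, x.val ∈ steps.map Prod.fst := by decide +kernel

lemma sum_mism (a : ℕ → Bool) (l : List (ℕ × List ℕ)) :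
    (l.map (fun q => mism a q.1 q.2)).sum = (edgeL l).countP (fun p => a p.1 != a p.2) := by
  induction l with
  | nil => rfl
  | cons q l ih =>
    rw [List.map_cons, List.sum_cons, ih]
    simp only [edgeL, List.flatMap_cons, List.countP_append, List.countP_map]
    rfl

lemma three_le_countP (a : ℕ → Bool) (l : List ℕ) (hl : ∀ x : Fin 34, x.val ∈ l)
    (x y z : Fin 34) (hx : a x) (hy : a y) (hz : a z) (hxy : x ≠ y) (hxz : x ≠ z) (hyz : y ≠ z) :
    3 ≤ l.countP (fun v => a v) := by
  rw [List.countP_eq_length_filter]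
  have hsub : ({x.val, y.val, z.val} : Finset ℕ) ⊆ (l.filter (fun v => a v)).toFinset := by
    intro u hu
    simp only [Finset.mem_insert, Finset.mem_singleton] at hu
    rw [List.mem_toFinset, List.mem_filter]
    rcases hu with rfl | rfl | rfl
    · exact ⟨hl x, hx⟩
    · exact ⟨hl y, hy⟩
    · exact ⟨hl z, hz⟩
  have h3 : ({x.val, y.val, z.val} : Finset ℕ).card = 3 := by
    rw [Finset.card_eq_three]
    exact ⟨_, _, _, fun h => hxy (Fin.ext h), fun h => hxz (Fin.ext h),
      fun h => hyz (Fin.ext h), rfl⟩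
  have := Finset.card_le_card hsub
  have := List.toFinset_card_le (l.filter (fun v => a v))
  omega

lemma countP_le_cut (A : Set (Fin 34)) (a : ℕ → Bool)
    (ha : ∀ n, a n = decide (Fin.ofNat 34 n ∈ A)) :
    (edgeL steps).countP (fun p => a p.1 != a p.2) ≤ (cutEdges PG A).ncard := by
  rw [List.countP_eq_length_filter]
  set F := (edgeL steps).filter (fun p => a p.1 != a p.2) with hF
  have hnd : (F.map toE).Nodup := edgeL_nodup.sublist (List.filter_sublist.map toE)
  have hcard := List.toFinset_card_of_nodup hnd
  rw [List.length_map] at hcard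
  rw [← hcard, ← Set.ncard_coe_finset]
  refine Set.ncard_le_ncard ?_ (Set.toFinite _)
  intro e he
  simp only [List.coe_toFinset, Set.mem_ofPred_eq, List.mem_map] at he
  obtain ⟨p, hp, rfl⟩ := he
  rw [hF, List.mem_filter] at hp
  obtain ⟨hp, hne⟩ := hp
  rw [ha, ha] at hne
  refine ⟨edgeL_adj p hp, ?_⟩
  by_cases h1 : Fin.ofNat 34 p.1 ∈ A
  · refine ⟨_, h1, Fin.ofNat 34 p.2, ?_, rfl⟩
    intro h2
    rw [decide_eq_true h1, decide_eq_true h2] at hne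
    exact absurd hne (by decide)
  · refine ⟨Fin.ofNat 34 p.2, ?_, _, h1, Sym2.eq_swap⟩
    by_contra h2
    rw [decide_eq_false h1, decide_eq_false h2] at hne
    exact absurd hne (by decide)

lemma PG_conn : CyclEdgeConn PG 5 := by
  intro A h1 h2
  obtain ⟨x, y, z, hx, hy, hz, hxy, hxz, hyz⟩ := three_of_hasCycle h1
  obtain ⟨x', y', z', hx', hy', hz', hxy', hxz', hyz'⟩ := three_of_hasCycle h2
  by_contra hlt
  have ha : ∀ n, (fun n : ℕ => decide (Fin.ofNat 34 n ∈ A)) n = decide (Fin.ofNat 34 n ∈ A) :=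
    fun _ => rfl
  generalize (fun n : ℕ => decide (Fin.ofNat 34 n ∈ A)) = a at ha
  have hc := countP_le_cut A a ha
  have hval : ∀ u : Fin 34, a u = decide (u ∈ A) := by
    intro u
    rw [ha, Fin.ofNat_val_eq_self]
  have := chk_sound a steps 0 0 0 0 0 chk_steps (by simp) (by simp)
    (by rw [sum_mism]; omega)
  have k1 := three_le_countP a (steps.map Prod.fst) steps_all x y z (by simpa [hval] using hx)
    (by simpa [hval] using hy) (by simpa [hval] using hz) hxy hxz hyz
  have k2 := three_le_countP (fun n => !a n) (steps.map Prod.fst) steps_all x' y' z'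
    (by simpa [hval] using hx') (by simpa [hval] using hy') (by simpa [hval] using hz')
    hxy' hxz' hyz'
  omega

/-! ### The weight -/

lemma wt_pos (e : Sym2 (Fin 34)) : wt e = 1 ∨ wt e = 2 := by
  induction e with
  | _ x y => rw [wt_mk]; split_ifs <;> simp

lemma ncard_le_cutWeight (A : Set (Fin 34)) : (cutEdges PG A).ncard ≤ cutWeight PG wt A := by
  unfold cutWeight
  rw [finsum_mem_eq_finite_toFinset_sum _ (Set.toFinite _),
    Set.ncard_eq_toFinset_card _ (Set.toFinite _), Finset.card_eq_sum_ones]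
  refine Finset.sum_le_sum fun e _ => ?_
  rcases wt_pos e with h | h <;> omega

/-- The weighted adjacency matrix. -/
def Wm (x y : Fin 34) : ℕ := if y = mt x then 2 else if y = pv x ∨ y = nx x then 1 else 0

lemma Wm_sum : ∀ x, ∑ y, Wm x y = 4 := by decide +kernel
lemma Wm_symm : ∀ x y, Wm x y = Wm y x := by decide +kernel
lemma Wm_diag : ∀ x, Wm x x = 0 := by decide +kernel

lemma even_inner (S : Finset (Fin 34)) : Even (∑ x ∈ S, ∑ y ∈ S, Wm x y) := by
  induction S using Finset.induction_on with
  | empty => simp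
  | insert v S hv ih =>
    have : ∑ x ∈ insert v S, ∑ y ∈ insert v S, Wm x y
        = 2 * ∑ y ∈ S, Wm v y + ∑ x ∈ S, ∑ y ∈ S, Wm x y := by
      simp only [Finset.sum_insert hv, Finset.sum_add_distrib, Wm_diag]
      have : ∑ x ∈ S, Wm x v = ∑ y ∈ S, Wm v y := Finset.sum_congr rfl fun x _ => Wm_symm x v
      rw [this]; ring
    rw [this]
    exact (even_two_mul _).add ih

lemma cutWeight_eq (A : Set (Fin 34)) :
    cutWeight PG wt A = ∑ x ∈ A.toFinset, ∑ y ∈ A.toFinsetᶜ, Wm x y := by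
  unfold cutWeight
  set P : Finset (Fin 34 × Fin 34) :=
    (A.toFinset ×ˢ A.toFinsetᶜ).filter (fun p => PG.Adj p.1 p.2) with hP
  have hinj : Set.InjOn (fun p : Fin 34 × Fin 34 => s(p.1, p.2)) (P : Set (Fin 34 × Fin 34)) := by
    rintro ⟨x, y⟩ h ⟨x', y'⟩ h' he
    simp only [hP, Finset.coe_filter, Finset.mem_product, Set.mem_toFinset, Finset.mem_compl,
      Set.mem_ofPred_eq] at h h'
    rcases Sym2.eq_iff.1 he with ⟨rfl, rfl⟩ | ⟨rfl, rfl⟩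
    · rfl
    · exact absurd h.1.1 h'.1.2
  have himg : cutEdges PG A = ((P.image fun p => s(p.1, p.2) : Finset (Sym2 (Fin 34))) :
      Set (Sym2 (Fin 34))) := by
    ext e
    simp only [cutEdges, hP, Finset.coe_image, Finset.coe_filter, Finset.mem_product,
      Set.mem_toFinset, Finset.mem_compl, Set.mem_ofPred_eq, Set.mem_image, Prod.exists]
    constructor
    · rintro ⟨he, x, hx, y, hy, rfl⟩
      exact ⟨x, y, ⟨⟨hx, hy⟩, he⟩, rfl⟩
    · rintro ⟨x, y, ⟨⟨hx, hy⟩, he⟩, rfl⟩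
      exact ⟨he, x, hx, y, hy, rfl⟩
  rw [himg, finsum_mem_coe_finset, Finset.sum_image hinj, hP, Finset.sum_filter,
    Finset.sum_product]
  refine Finset.sum_congr rfl fun x _ => Finset.sum_congr rfl fun y _ => ?_
  simp only [PG_adj, wt_mk, Wm]
  by_cases h1 : y = mt x <;> by_cases h2 : y = pv x <;> by_cases h3 : y = nx x <;>
    simp [h1, h2, h3]

lemma wt_eulerian : IsEulerianWeight PG wt := by
  refine ⟨fun e _ => wt_pos e, fun A => ?_⟩
  rw [cutWeight_eq]
  have h : (∑ x ∈ A.toFinset, ∑ y ∈ A.toFinset, Wm x y) +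
      ∑ x ∈ A.toFinset, ∑ y ∈ A.toFinsetᶜ, Wm x y = A.toFinset.card * 4 := by
    rw [← Finset.sum_add_distrib, ← smul_eq_mul, ← Finset.sum_const]
    refine Finset.sum_congr rfl fun x _ => ?_
    rw [Finset.sum_add_sum_compl, Wm_sum]
  have h1 := even_inner A.toFinset
  have h2 : Even (A.toFinset.card * 4) := (by decide : Even 4).mul_left _
  rw [← h, Nat.even_add] at h2
  exact h2.1 h1

/-! ### No compatible cycle cover -/

/-- Replace the label `x` by `y`. -/
def sub (x y z : ℕ) : ℕ := bif Nat.beq z x then y else z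

/-- Identify the labels `x0 = y0` and `x1 = y1`. -/
def sub2 (x0 y0 x1 y1 z : ℕ) : ℕ := sub (sub x0 y0 x1) (sub x0 y0 y1) (sub x0 y0 z)

/-- Branch on the two ways to pair up the labels at every matching edge. -/
def srch : ℕ → List (ℕ × ℕ × ℕ × ℕ) → List (ℕ × ℕ) → Bool
  | 0, _, _ => false
  | _ + 1, [], _ => false
  | n + 1, (x0, x1, x2, x3) :: rest, ne =>
    let f := sub2 x0 x2 x1 x3
    let g := sub2 x0 x3 x1 x2
    let nf := ne.map (fun p => (f p.1, f p.2))
    let ng := ne.map (fun p => (g p.1, g p.2))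
    (nf.any (fun p => Nat.beq p.1 p.2) ||
      srch n (rest.map (fun q => (f q.1, f q.2.1, f q.2.2.1, f q.2.2.2))) nf) &&
    (ng.any (fun p => Nat.beq p.1 p.2) ||
      srch n (rest.map (fun q => (g q.1, g q.2.1, g q.2.2.1, g q.2.2.2))) ng)

def quads : List (ℕ × ℕ × ℕ × ℕ) :=
  ((List.finRange 34).take 17).map (fun v => (v.val, (pv v).val, (mt v).val, (pv (mt v)).val))

def nes : List (ℕ × ℕ) := (List.finRange 34).map (fun v => (v.val, (pv v).val))

lemma srch_true : srch 17 quads nes = true := by decide +kernel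

def GoodQuad {α : Type*} (c : ℕ → α) (q : ℕ × ℕ × ℕ × ℕ) : Prop :=
  (c q.1 = c q.2.2.1 ∧ c q.2.1 = c q.2.2.2) ∨ (c q.1 = c q.2.2.2 ∧ c q.2.1 = c q.2.2.1)

lemma sub_eq {α : Type*} (c : ℕ → α) {x y : ℕ} (h : c x = c y) (z : ℕ) :
    c (sub x y z) = c z := by
  unfold sub
  cases hz : Nat.beq z x
  · rfl
  · rw [Nat.eq_of_beq_eq_true hz]; exact h.symm

lemma sub2_eq {α : Type*} (c : ℕ → α) {x0 y0 x1 y1 : ℕ} (h : c x0 = c y0) (h' : c x1 = c y1)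
    (z : ℕ) : c (sub2 x0 y0 x1 y1 z) = c z := by
  unfold sub2
  rw [sub_eq c, sub_eq c h]
  rw [sub_eq c h, sub_eq c h, h']

lemma srch_sound {α : Type*} (c : ℕ → α) : ∀ (n : ℕ) (qs : List (ℕ × ℕ × ℕ × ℕ))
    (ne : List (ℕ × ℕ)), srch n qs ne = true → (∀ q ∈ qs, GoodQuad c q) →
    (∀ p ∈ ne, c p.1 ≠ c p.2) → False := by
  intro n
  induction n with
  | zero => intro qs ne h; simp [srch] at h
  | succ n ih =>
    intro qs ne h hq hne
    cases qs with
    | nil => simp [srch] at h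
    | cons q rest =>
      obtain ⟨x0, x1, x2, x3⟩ := q
      have step : ∀ f : ℕ → ℕ, (∀ z, c (f z) = c z) →
          ((ne.map (fun p => (f p.1, f p.2))).any (fun p => Nat.beq p.1 p.2) ||
            srch n (rest.map (fun q => (f q.1, f q.2.1, f q.2.2.1, f q.2.2.2)))
              (ne.map (fun p => (f p.1, f p.2)))) = true → False := by
        intro f hf hs
        have hne' : ∀ p ∈ ne.map (fun p => (f p.1, f p.2)), c p.1 ≠ c p.2 := by
          intro p hp
          obtain ⟨p, hp₁, rfl⟩ := List.mem_map.1 hp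
          simp only [hf]
          exact hne p hp₁
        rcases (Bool.or_eq_true _ _).mp hs with hs | hs
        · obtain ⟨p, hp, he⟩ := List.any_eq_true.1 hs
          exact hne' p hp (congrArg c (Nat.eq_of_beq_eq_true he))
        · refine ih _ _ hs ?_ hne'
          intro q hq'
          obtain ⟨q, hq₁, rfl⟩ := List.mem_map.1 hq'
          have := hq q (List.mem_cons_of_mem _ hq₁)
          unfold GoodQuad at *
          simp only [hf]
          exact this
      have h' := (Bool.and_eq_true _ _).mp h
      rcases hq _ List.mem_cons_self with ⟨e1, e2⟩ | ⟨e1, e2⟩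
      · exact step _ (sub2_eq c e1 e2) h'.1
      · exact step _ (sub2_eq c e1 e2) h'.2

lemma no_cover : ¬ ∃ D : Multiset PG.Subgraph, IsCompatibleCycleCover PG wt D := by
  rintro ⟨D, hcyc, hD⟩
  have hnx : ∀ v, ∃ C₀ : PG.Subgraph, ∀ C, (C ∈ D ∧ C.Adj v (nx v)) ↔ C = C₀ := by
    intro v
    have h := hD s(v, nx v) (Or.inr (Or.inl rfl))
    rw [wt_mk, if_neg (nx_ne_mt v), Multiset.countP_eq_card_filter, Multiset.card_eq_one] at h
    obtain ⟨C₀, h⟩ := h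
    refine ⟨C₀, fun C => ?_⟩
    rw [← Multiset.mem_singleton, ← h, Multiset.mem_filter, SimpleGraph.Subgraph.mem_edgeSet]
  have hmt : ∀ v, ∃ C ∈ D, C.Adj v (mt v) := by
    intro v
    have h := hD s(v, mt v) (Or.inr (Or.inr rfl))
    rw [wt_mk, if_pos rfl] at h
    have h0 : 0 < D.countP (fun C => s(v, mt v) ∈ C.edgeSet) := by omega
    obtain ⟨C, hC, h1⟩ := Multiset.countP_pos.1 h0
    exact ⟨C, hC, h1⟩
  choose c hc using hnx
  have hcn : ∀ v, c v ∈ D ∧ (c v).Adj v (nx v) := fun v => (hc v _).2 rfl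
  have hcp : ∀ v, c (pv v) ∈ D ∧ (c (pv v)).Adj v (pv v) := by
    intro v
    have := hcn (pv v)
    rw [nx_pv] at this
    exact ⟨this.1, this.2.symm⟩
  have un : ∀ v C, C ∈ D → C.Adj v (nx v) → C = c v := fun v C h h' => (hc v C).1 ⟨h, h'⟩
  have up : ∀ v C, C ∈ D → C.Adj v (pv v) → C = c (pv v) := by
    intro v C h h'
    refine un _ C h ?_
    rw [nx_pv]
    exact h'.symm
  have um : ∀ v C, C ∈ D → C.Adj v (mt v) → C = c v ∨ C = c (pv v) := by
    intro v C h h'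
    rcases cycle_local (hcyc C h) h' with ⟨_, _, k⟩ | ⟨k, _, _⟩ | ⟨_, k, _⟩
    · exact absurd h' k
    · exact Or.inr (up v C h k)
    · exact Or.inl (un v C h k)
  have hne : ∀ v, c v ≠ c (pv v) := by
    intro v he
    have h1 := hcn v
    have h2 := (hcp v).2
    rw [← he] at h2
    have hno : ¬ (c v).Adj v (mt v) := by
      rcases cycle_local (hcyc _ h1.1) h1.2 with ⟨_, _, k⟩ | ⟨_, k, _⟩ | ⟨k, _, _⟩
      · exact k
      · exact absurd h1.2 k
      · exact absurd h2 k
    obtain ⟨C, hC, hm⟩ := hmt v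
    rcases um v C hC hm with h | h
    · exact hno (h ▸ hm)
    · rw [← he] at h
      exact hno (h ▸ hm)
  have cm : ∀ v, (c v).Adj v (mt v) := by
    intro v
    have h1 := hcn v
    rcases cycle_local (hcyc _ h1.1) h1.2 with ⟨k, _, _⟩ | ⟨_, _, k⟩ | ⟨_, _, k⟩
    · exact absurd (up v _ h1.1 k) (hne v)
    · exact k
    · exact k
  have cpm : ∀ v, (c (pv v)).Adj v (mt v) := by
    intro v
    have h1 := hcp v
    rcases cycle_local (hcyc _ h1.1) h1.2 with ⟨_, k, _⟩ | ⟨_, _, k⟩ | ⟨_, _, k⟩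
    · exact absurd (un v _ h1.1 k).symm (hne v)
    · exact k
    · exact k
  have hquad : ∀ v, (c v = c (mt v) ∧ c (pv v) = c (pv (mt v))) ∨
      (c v = c (pv (mt v)) ∧ c (pv v) = c (mt v)) := by
    intro v
    have a1 := um (mt v) (c v) (hcn v).1 (by rw [mt_mt]; exact (cm v).symm)
    have a2 := um (mt v) (c (pv v)) (hcp v).1 (by rw [mt_mt]; exact (cpm v).symm)
    have a3 := hne v
    rcases a1 with a1 | a1 <;> rcases a2 with a2 | a2
    · exact absurd (a1.trans a2.symm) a3
    · exact Or.inl ⟨a1, a2⟩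
    · exact Or.inr ⟨a1, a2⟩
    · exact absurd (a1.trans a2.symm) a3
  refine srch_sound (fun n => c (Fin.ofNat 34 n)) 17 quads nes srch_true ?_ ?_
  · intro q hq
    obtain ⟨v, _, rfl⟩ := List.mem_map.1 hq
    simp only [GoodQuad, Fin.ofNat_val_eq_self]
    exact hquad v
  · intro p hp
    obtain ⟨v, _, rfl⟩ := List.mem_map.1 hp
    simp only [Fin.ofNat_val_eq_self]
    exact hne v

/-- there is a cyclically 5-edge-connected cubic graph on 34 vertices with an
eulerian (1,2)-weight whose weight sum over every cyclic edge cut exceeds 4 and which admits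
no compatible cycle cover (refuting the conjecture of Zhang, and hence those of Fleischner,
Genest and Jackson). -/
theorem exists_cubic_34_eulerian_weight_no_compatible_cover :
    ∃ G : SimpleGraph (Fin 34), IsCubic G ∧ CyclEdgeConn G 5 ∧
      ∃ w : Sym2 (Fin 34) → ℕ, IsEulerianWeight G w ∧
        (∀ A : Set (Fin 34), HasCycleIn G A → HasCycleIn G Aᶜ → 4 < cutWeight G w A) ∧
        ¬ ∃ D : Multiset G.Subgraph, IsCompatibleCycleCover G w D := by
  exact ⟨PG, PG_cubic, PG_conn, wt, wt_eulerian,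
    fun A h1 h2 => lt_of_lt_of_le (PG_conn A h1 h2) (ncard_le_cutWeight A), no_cover⟩

end SnarkPaper
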